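/- arXiv:1903.06309 — 6 statements merged into one kernel-verified Lean document; each statement's English description precedes it below -/
import Mathlib

section
/- For all real σ, d, w > 0, the derivative with respect to σ of the value function V(σ, d, w) vanishes at σ if and only if σ² = (2dw + w²) / (2·ln(1 + w/d)); equivalently, if and only if d·exp(−d²/(2σ²)) = (d + w)·exp(−(d + w)²/(2σ²)). -/
open Real MeasureTheory

/-- Gaussian density with mean 0 and standard deviation `σ`. -/
noncomputable def gauss (σ x : ℝ) : ℝ :=
  (1 / (σ * Real.sqrt (2 * Real.pi))) * Real.exp (-x ^ 2 / (2 * σ ^ 2))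

/-- The value function: probability that a `N(0, σ²)` variable lies in `[d, d+w]`. -/
noncomputable def V (σ d w : ℝ) : ℝ := ∫ x in d..(d + w), gauss σ x

theorem gauss_eq_inv_mul_gauss_one {σ : ℝ} (hσ : σ ≠ 0) (x : ℝ) :
    gauss σ x = σ⁻¹ * gauss 1 (x / σ) := by
  have h : -x ^ 2 / (2 * σ ^ 2) = -(x / σ) ^ 2 / (2 * 1 ^ 2) := by
    field_simp
  unfold gauss
  rw [h]
  field_simp

theorem continuous_gauss (σ : ℝ) : Continuous (gauss σ) := by
  unfold gauss
  fun_prop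

theorem V_eq_integral_gauss_one {σ : ℝ} (hσ : σ ≠ 0) (d w : ℝ) :
    V σ d w = ∫ x in (d / σ)..((d + w) / σ), gauss 1 x := by
  simp only [V, gauss_eq_inv_mul_gauss_one hσ, intervalIntegral.integral_const_mul,
    intervalIntegral.integral_comp_div (gauss 1) hσ, smul_eq_mul, inv_mul_cancel_left₀ hσ]

theorem hasDerivAt_integral_gauss_one_div {σ : ℝ} (hσ : σ ≠ 0) (a : ℝ) :
    HasDerivAt (fun s => ∫ x in (0 : ℝ)..(a / s), gauss 1 x)
      (-(a * gauss σ a) / σ) σ := by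
  have hF := (continuous_gauss 1).integral_hasStrictDerivAt 0 (a / σ)
  have hdiv : HasDerivAt (fun s : ℝ => a / s) (-a / σ ^ 2) σ := by
    simpa [div_eq_mul_inv] using (hasDerivAt_inv hσ).const_mul a
  refine (hF.hasDerivAt.comp σ hdiv).congr_deriv ?_
  rw [gauss_eq_inv_mul_gauss_one hσ]
  field_simp

theorem hasDerivAt_V {σ : ℝ} (hσ : σ ≠ 0) (d w : ℝ) :
    HasDerivAt (fun s => V s d w) ((d * gauss σ d - (d + w) * gauss σ (d + w)) / σ) σ := by
  have h := (hasDerivAt_integral_gauss_one_div hσ (d + w)).sub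
    (hasDerivAt_integral_gauss_one_div hσ d)
  refine (h.congr_deriv (by ring)).congr_of_eventuallyEq ?_
  filter_upwards [eventually_ne_nhds hσ] with s hs
  rw [V_eq_integral_gauss_one hs, Pi.sub_apply]
  exact (intervalIntegral.integral_interval_sub_left
    ((continuous_gauss 1).intervalIntegrable _ _)
    ((continuous_gauss 1).intervalIntegrable _ _)).symm

theorem deriv_V_eq_zero_iff_mul_exp_eq {σ : ℝ} (hσ : 0 < σ) (d w : ℝ) :
    deriv (fun s => V s d w) σ = 0 ↔
      d * Real.exp (-d ^ 2 / (2 * σ ^ 2)) =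
        (d + w) * Real.exp (-(d + w) ^ 2 / (2 * σ ^ 2)) := by
  have hc : 1 / (σ * Real.sqrt (2 * Real.pi)) ≠ 0 := by positivity
  rw [(hasDerivAt_V hσ.ne' d w).deriv, div_eq_zero_iff, or_iff_left hσ.ne', sub_eq_zero]
  unfold gauss
  rw [mul_left_comm d, mul_left_comm (d + w), mul_right_inj' hc]

theorem mul_exp_eq_iff_sq_eq {σ d w : ℝ} (hσ : 0 < σ) (hd : 0 < d) (hw : 0 < w) :
    d * Real.exp (-d ^ 2 / (2 * σ ^ 2)) =
        (d + w) * Real.exp (-(d + w) ^ 2 / (2 * σ ^ 2)) ↔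
      σ ^ 2 = (2 * d * w + w ^ 2) / (2 * Real.log (1 + w / d)) := by
  have hdw : 0 < d + w := by positivity
  have hlog : Real.log (1 + w / d) = Real.log (d + w) - Real.log d := by
    rw [← Real.log_div hdw.ne' hd.ne', add_div, div_self hd.ne']
  have hpos : 0 < Real.log (1 + w / d) :=
    Real.log_pos (lt_add_of_pos_right _ (div_pos hw hd))
  have hA : -d ^ 2 / (2 * σ ^ 2) - -(d + w) ^ 2 / (2 * σ ^ 2) =
      (2 * d * w + w ^ 2) / (2 * σ ^ 2) := by ring
  have hiff : Real.log (1 + w / d) = (2 * d * w + w ^ 2) / (2 * σ ^ 2) ↔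
      σ ^ 2 = (2 * d * w + w ^ 2) / (2 * Real.log (1 + w / d)) := by
    rw [eq_div_iff (by positivity), eq_div_iff (by positivity)]
    constructor <;> intro h <;> linarith
  rw [← hiff, ← hA, hlog, ← Real.log_injOn_pos.eq_iff (Set.mem_Ioi.2 (by positivity))
      (Set.mem_Ioi.2 (by positivity)), Real.log_mul hd.ne' (Real.exp_ne_zero _),
    Real.log_mul hdw.ne' (Real.exp_ne_zero _), Real.log_exp, Real.log_exp]
  constructor <;> intro h <;> linarith

theorem deriv_V_eq_zero_iff (σ d w : ℝ) (hσ : 0 < σ) (hd : 0 < d) (hw : 0 < w) :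
    (deriv (fun s => V s d w) σ = 0 ↔
      σ ^ 2 = (2 * d * w + w ^ 2) / (2 * Real.log (1 + w / d))) ∧
    (deriv (fun s => V s d w) σ = 0 ↔
      d * Real.exp (-d ^ 2 / (2 * σ ^ 2)) =
        (d + w) * Real.exp (-(d + w) ^ 2 / (2 * σ ^ 2))) := by
  have h := deriv_V_eq_zero_iff_mul_exp_eq hσ d w
  exact ⟨h.trans (mul_exp_eq_iff_sq_eq hσ hd hw), h⟩
end

section
/- (Lemma 1) For all real d, w > 0, the value σ*(d, w) = sqrt((2dw + w²) / (2·ln(1 + w/d))) is the unique global maximizer of σ ↦ V(σ, d, w) over σ ∈ (0, ∞): for every σ > 0 with σ ≠ σ*(d, w), one has V(σ, d, w) < V(σ*(d, w), d, w). -/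
open Real MeasureTheory

/-- The claimed optimal standard deviation. -/
noncomputable def sigmaStar (d w : ℝ) : ℝ :=
  Real.sqrt ((2 * d * w + w ^ 2) / (2 * Real.log (1 + w / d)))

/-- The unnormalised Gaussian mass of the interval `[t * a, t * b]`. -/
noncomputable def scaledMass (a b t : ℝ) : ℝ := ∫ u in (t * a)..(t * b), exp (-u ^ 2 / 2)

lemma continuous_exp_neg_sq_div_two : Continuous fun u : ℝ => exp (-u ^ 2 / 2) := by
  fun_prop

lemma hasDerivAt_scaledMass (a b t : ℝ) :
    HasDerivAt (scaledMass a b)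
      (exp (-(t * b) ^ 2 / 2) * b - exp (-(t * a) ^ 2 / 2) * a) t := by
  have hc := continuous_exp_neg_sq_div_two
  have hG (y : ℝ) : HasDerivAt (fun y => ∫ u in (0 : ℝ)..y, exp (-u ^ 2 / 2))
      (exp (-y ^ 2 / 2)) y := hc.integral_hasStrictDerivAt 0 y |>.hasDerivAt
  have hcomp (c : ℝ) : HasDerivAt (fun t => ∫ u in (0 : ℝ)..(t * c), exp (-u ^ 2 / 2))
      (exp (-(t * c) ^ 2 / 2) * c) t :=
    HasDerivAt.comp (h := fun t => t * c) t (hG (t * c)) (hasDerivAt_mul_const c)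
  refine ((hcomp b).sub (hcomp a)).congr_of_eventuallyEq (.of_forall fun s => ?_)
  exact (intervalIntegral.integral_interval_sub_left
    (hc.intervalIntegrable _ _) (hc.intervalIntegrable _ _)).symm

lemma exp_mul_eq_exp_log {c : ℝ} (hc : 0 < c) (t : ℝ) :
    exp (-(t * c) ^ 2 / 2) * c = exp (-(t * c) ^ 2 / 2 + log c) := by
  rw [exp_add, exp_log hc]

lemma strictMonoOn_scaledMass {a b s : ℝ} (ha : 0 < a) (hab : a < b)
    (hs : s ^ 2 * (b ^ 2 - a ^ 2) = 2 * (log b - log a)) :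
    StrictMonoOn (scaledMass a b) (Set.Icc 0 s) := by
  refine strictMonoOn_of_deriv_pos (convex_Icc 0 s)
    (fun t _ => (hasDerivAt_scaledMass a b t).continuousAt.continuousWithinAt) fun t ht => ?_
  rw [interior_Icc] at ht
  rw [(hasDerivAt_scaledMass a b t).deriv, sub_pos, exp_mul_eq_exp_log ha,
    exp_mul_eq_exp_log (ha.trans hab), exp_lt_exp]
  have hts : t ^ 2 < s ^ 2 := pow_lt_pow_left₀ ht.2 ht.1.le two_ne_zero
  have hba : 0 < b ^ 2 - a ^ 2 := sub_pos.2 (pow_lt_pow_left₀ hab ha.le two_ne_zero)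
  linarith [mul_lt_mul_of_pos_right hts hba]

lemma strictAntiOn_scaledMass {a b s : ℝ} (ha : 0 < a) (hab : a < b) (hs₀ : 0 ≤ s)
    (hs : s ^ 2 * (b ^ 2 - a ^ 2) = 2 * (log b - log a)) :
    StrictAntiOn (scaledMass a b) (Set.Ici s) := by
  refine strictAntiOn_of_deriv_neg (convex_Ici s)
    (fun t _ => (hasDerivAt_scaledMass a b t).continuousAt.continuousWithinAt) fun t ht => ?_
  rw [interior_Ici] at ht
  rw [(hasDerivAt_scaledMass a b t).deriv, sub_neg, exp_mul_eq_exp_log ha,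
    exp_mul_eq_exp_log (ha.trans hab), exp_lt_exp]
  have hts : s ^ 2 < t ^ 2 := pow_lt_pow_left₀ ht hs₀ two_ne_zero
  have hba : 0 < b ^ 2 - a ^ 2 := sub_pos.2 (pow_lt_pow_left₀ hab ha.le two_ne_zero)
  linarith [mul_lt_mul_of_pos_right hts hba]

lemma scaledMass_lt_of_ne {a b s t : ℝ} (ha : 0 < a) (hab : a < b) (hs₀ : 0 ≤ s) (ht : 0 ≤ t)
    (hs : s ^ 2 * (b ^ 2 - a ^ 2) = 2 * (log b - log a)) (hts : t ≠ s) :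
    scaledMass a b t < scaledMass a b s := by
  rcases hts.lt_or_gt with h | h
  · exact strictMonoOn_scaledMass ha hab hs ⟨ht, h.le⟩ ⟨hs₀, le_rfl⟩ h
  · exact strictAntiOn_scaledMass ha hab hs₀ hs Set.self_mem_Ici h.le h

lemma V_eq_scaledMass {σ : ℝ} (hσ : 0 < σ) (d w : ℝ) :
    V σ d w = (√(2 * π))⁻¹ * scaledMass d (d + w) σ⁻¹ := by
  have h := intervalIntegral.integral_comp_div (a := d) (b := d + w)
    (fun u : ℝ => exp (-u ^ 2 / 2)) hσ.ne'
  have hexp (x : ℝ) : -x ^ 2 / (2 * σ ^ 2) = -(x / σ) ^ 2 / 2 := by field_simp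
  simp only [V, gauss, hexp, intervalIntegral.integral_const_mul, h, scaledMass, smul_eq_mul,
    inv_mul_eq_div]
  field_simp

lemma log_one_add_div_pos {d w : ℝ} (hd : 0 < d) (hw : 0 < w) : 0 < log (1 + w / d) :=
  log_pos (lt_add_of_pos_right 1 (div_pos hw hd))

lemma sigmaStar_pos {d w : ℝ} (hd : 0 < d) (hw : 0 < w) : 0 < sigmaStar d w := by
  have := log_one_add_div_pos hd hw
  unfold sigmaStar
  positivity

lemma inv_sigmaStar_sq_mul {d w : ℝ} (hd : 0 < d) (hw : 0 < w) :
    (sigmaStar d w)⁻¹ ^ 2 * ((d + w) ^ 2 - d ^ 2) = 2 * (log (d + w) - log d) := by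
  have hL := log_one_add_div_pos hd hw
  have hlog : log (d + w) - log d = log (1 + w / d) := by
    rw [← log_div (by positivity) hd.ne', add_div, div_self hd.ne']
  have hsq : (d + w) ^ 2 - d ^ 2 = 2 * d * w + w ^ 2 := by ring
  have hN : 2 * d * w + w ^ 2 ≠ 0 := by positivity
  rw [hlog, hsq, inv_pow, sigmaStar, sq_sqrt (by positivity), inv_div, div_mul_cancel₀ _ hN]

theorem sigmaStar_unique_global_max (d w : ℝ) (hd : 0 < d) (hw : 0 < w) :
    ∀ σ : ℝ, 0 < σ → σ ≠ sigmaStar d w → V σ d w < V (sigmaStar d w) d w := by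
  intro σ hσ hne
  have hpos := sigmaStar_pos hd hw
  rw [V_eq_scaledMass hσ, V_eq_scaledMass hpos]
  exact mul_lt_mul_of_pos_left
    (scaledMass_lt_of_ne hd (lt_add_of_pos_right d hw) (inv_nonneg.2 hpos.le)
      (inv_nonneg.2 hσ.le) (inv_sigmaStar_sq_mul hd hw) (inv_injective.ne hne))
    (by positivity)
end

section
/- For all real d, w > 0, the optimal standard deviation satisfies d < σ*(d, w) < d + w, i.e. d < sqrt((2dw + w²) / (2·ln(1 + w/d))) < d + w. -/
open Real

theorem sigmaStar_between (d w : ℝ) (hd : 0 < d) (hw : 0 < w) :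
    d < sigmaStar d w ∧ sigmaStar d w < d + w := by
  have hx : 1 < 1 + w / d := lt_add_of_pos_right 1 (div_pos hw hd)
  have hL : 0 < 2 * Real.log (1 + w / d) := mul_pos two_pos (Real.log_pos hx)
  have hlog : Real.log ((1 + w / d) ^ 2) = 2 * Real.log (1 + w / d) := by
    rw [Real.log_pow]; norm_num
  have hy : 1 < (1 + w / d) ^ 2 := one_lt_pow₀ hx two_ne_zero
  have hy0 : 0 < (1 + w / d) ^ 2 := one_pos.trans hy
  have hyd : d ^ 2 * (1 + w / d) ^ 2 = (d + w) ^ 2 := by field_simp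
  have upper := Real.log_lt_sub_one_of_pos hy0 hy.ne'
  have lower := Real.log_lt_sub_one_of_pos (inv_pos.mpr hy0) (inv_lt_one_of_one_lt₀ hy).ne
  rw [hlog] at upper
  rw [Real.log_inv, hlog] at lower
  unfold sigmaStar
  constructor
  · rw [Real.lt_sqrt hd.le, lt_div_iff₀ hL]
    nlinarith [mul_lt_mul_of_pos_left upper (pow_pos hd 2)]
  · rw [Real.sqrt_lt' (add_pos hd hw), div_lt_iff₀ hL]
    have hinv : (d + w) ^ 2 * ((1 + w / d) ^ 2)⁻¹ = d ^ 2 := by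
      rw [← hyd, mul_assoc, mul_inv_cancel₀ hy0.ne', mul_one]
    nlinarith [mul_lt_mul_of_pos_left lower (pow_pos (add_pos hd hw) 2)]
end

section
/- For every fixed w > 0, the map d ↦ σ*(d, w) = sqrt((2dw + w²) / (2·ln(1 + w/d))) is strictly increasing on (0, ∞): for all 0 < d₁ < d₂, σ*(d₁, w) < σ*(d₂, w). -/
open Real

theorem sigmaStar_strictMono_in_d (w : ℝ) (hw : 0 < w) :
    ∀ d₁ d₂ : ℝ, 0 < d₁ → d₁ < d₂ → sigmaStar d₁ w < sigmaStar d₂ w := by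
  intro d₁ d₂ h₁ h₁₂
  have h₂ : 0 < d₂ := h₁.trans h₁₂
  have hquot : w / d₂ < w / d₁ := div_lt_div_of_pos_left hw h₁ h₁₂
  have hpos : 0 < w / d₂ := div_pos hw h₂
  have hlog_pos : 0 < Real.log (1 + w / d₂) := Real.log_pos (by linarith)
  have hlog : Real.log (1 + w / d₂) < Real.log (1 + w / d₁) :=
    Real.log_lt_log (by linarith) (by linarith)
  have hnum : 2 * d₁ * w + w ^ 2 < 2 * d₂ * w + w ^ 2 := by
    nlinarith [mul_lt_mul_of_pos_right h₁₂ hw]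
  unfold sigmaStar
  refine Real.sqrt_lt_sqrt (div_nonneg (by positivity) (by linarith)) ?_
  exact div_lt_div₀ hnum (by linarith) (by positivity) (by linarith)
end

section
/- (Theorem 1, asymptotic form) For every fixed d > 0, lim_{w → 0⁺} [ √(2πe) · σ*(d, w) · V(σ*(d, w), d, w) / w ] = 1; that is, in the regime d ≫ w the optimal variance satisfies σ* ≈ w / (√(2πe) · V(σ*, d)). -/
open Real MeasureTheory

open Filter Topology

lemma tendsto_sigmaStar {d : ℝ} (hd : 0 < d) :
    Tendsto (sigmaStar d) (𝓝[>] 0) (𝓝 d) := by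
  have hderiv : HasDerivAt (fun w : ℝ => Real.log (1 + w / d)) (1 / d) 0 := by
    have h := (((hasDerivAt_id (0 : ℝ)).div_const d).const_add 1).log (by simp)
    simpa using h
  have hslope : Tendsto (fun w : ℝ => w⁻¹ * Real.log (1 + w / d)) (𝓝[>] 0) (𝓝 (1 / d)) := by
    simpa using hderiv.tendsto_slope_zero_right
  have hnum : Tendsto (fun w : ℝ => 2 * d + w) (𝓝[>] 0) (𝓝 (2 * d)) := by
    have h : Continuous fun w : ℝ => 2 * d + w := by fun_prop
    simpa using (h.tendsto 0).mono_left nhdsWithin_le_nhds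
  have hquot := (hnum.div (hslope.const_mul 2) (by positivity)).sqrt
  have hval : Real.sqrt (2 * d / (2 * (1 / d))) = d := by
    rw [show 2 * d / (2 * (1 / d)) = d ^ 2 by field_simp, Real.sqrt_sq hd.le]
  rw [hval] at hquot
  refine hquot.congr' ?_
  filter_upwards [self_mem_nhdsWithin] with w hw
  have hw : 0 < w := hw
  have hlog : 0 < Real.log (1 + w / d) := Real.log_pos (by linarith [div_pos hw hd])
  simp only [sigmaStar, Pi.div_apply]
  congr 1
  field_simp

lemma mul_V {σ : ℝ} (hσ : 0 < σ) (d w : ℝ) :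
    Real.sqrt (2 * Real.pi * Real.exp 1) * σ * V σ d w =
      Real.exp (1 / 2) * ∫ x in d..(d + w), Real.exp (-x ^ 2 / (2 * σ ^ 2)) := by
  have hpi : 0 < Real.sqrt (2 * Real.pi) := by positivity
  simp only [V, gauss, intervalIntegral.integral_const_mul]
  rw [Real.sqrt_mul (by positivity), Real.exp_half]
  field_simp

lemma integral_gaussian_kernel_mem_Icc {d w : ℝ} (hd : 0 < d) (hw : 0 < w) (σ : ℝ) :
    (∫ x in d..(d + w), Real.exp (-x ^ 2 / (2 * σ ^ 2))) ∈
      Set.Icc (w * Real.exp (-(d + w) ^ 2 / (2 * σ ^ 2))) (w * Real.exp (-d ^ 2 / (2 * σ ^ 2))) := by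
  have hcont : Continuous fun x : ℝ => Real.exp (-x ^ 2 / (2 * σ ^ 2)) := by fun_prop
  have hle : d ≤ d + w := by linarith
  constructor
  · calc w * Real.exp (-(d + w) ^ 2 / (2 * σ ^ 2))
        = ∫ _ in d..(d + w), Real.exp (-(d + w) ^ 2 / (2 * σ ^ 2)) := by simp
      _ ≤ _ := by
        refine intervalIntegral.integral_mono_on hle (by simp) (hcont.intervalIntegrable _ _) ?_
        intro x hx
        have : 0 ≤ x := hd.le.trans hx.1
        have := hx.2
        gcongr
  · calc _ ≤ ∫ _ in d..(d + w), Real.exp (-d ^ 2 / (2 * σ ^ 2)) := by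
          refine intervalIntegral.integral_mono_on hle (hcont.intervalIntegrable _ _) (by simp) ?_
          intro x hx
          have := hx.1
          gcongr
      _ = _ := by simp

theorem sigmaStar_asymptotic (d : ℝ) (hd : 0 < d) :
    Filter.Tendsto
      (fun w => Real.sqrt (2 * Real.pi * Real.exp 1) * sigmaStar d w *
        V (sigmaStar d w) d w / w)
      (nhdsWithin 0 (Set.Ioi 0)) (nhds 1) := by
  have hσ := tendsto_sigmaStar hd
  have hexp {f : ℝ → ℝ} (hf : Tendsto f (𝓝[>] 0) (𝓝 d)) :
      Tendsto (fun w => Real.exp (1 / 2) * Real.exp (-f w ^ 2 / (2 * sigmaStar d w ^ 2)))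
        (𝓝[>] 0) (𝓝 1) := by
    have h := ((((hf.pow 2).neg.div ((hσ.pow 2).const_mul 2) (by positivity)).rexp).const_mul
      (Real.exp (1 / 2)))
    have hval : Real.exp (1 / 2) * Real.exp (-d ^ 2 / (2 * d ^ 2)) = 1 := by
      rw [← Real.exp_add, Real.exp_eq_one_iff]
      field_simp
      ring
    rwa [hval] at h
  have hend : Tendsto (fun w : ℝ => d + w) (𝓝[>] 0) (𝓝 d) := by
    have h : Continuous fun w : ℝ => d + w := by fun_prop
    simpa using (h.tendsto 0).mono_left nhdsWithin_le_nhds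
  refine tendsto_of_tendsto_of_tendsto_of_le_of_le' (hexp hend) (hexp tendsto_const_nhds) ?_ ?_
  all_goals
    filter_upwards [self_mem_nhdsWithin, hσ.eventually (lt_mem_nhds hd)] with w hw hpos
    have hw : 0 < w := hw
    obtain ⟨hlower, hupper⟩ := integral_gaussian_kernel_mem_Icc hd hw (sigmaStar d w)
    rw [mul_V hpos, mul_div_assoc]
    gcongr
  · rwa [le_div_iff₀' hw]
  · rwa [div_le_iff₀' hw]
end

section
/- For every fixed w > 0, the optimal value is strictly decreasing in the distance d: for all 0 < d₁ < d₂, V(σ*(d₂, w), d₂, w) < V(σ*(d₁, w), d₁, w), where σ*(d, w) = sqrt((2dw + w²) / (2·ln(1 + w/d))). -/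
open Real MeasureTheory

lemma mul_exp_neg_sq_eq {a : ℝ} (ha : 0 < a) (s : ℝ) :
    a * exp (-(a * s) ^ 2 / 2) = exp (log a - (a * s) ^ 2 / 2) := by
  rw [sub_eq_add_neg, exp_add, exp_log ha, neg_div]

lemma V_eq_integral_exp {σ : ℝ} (hσ : 0 < σ) (d w : ℝ) :
    V σ d w = (1 / √(2 * π)) * ∫ x in (d * σ⁻¹)..((d + w) * σ⁻¹), exp (-x ^ 2 / 2) := by
  have hg : ∀ x, gauss σ x = (1 / √(2 * π)) * (σ⁻¹ * exp (-(σ⁻¹ * x) ^ 2 / 2)) := by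
    intro x
    have he : -x ^ 2 / (2 * σ ^ 2) = -(σ⁻¹ * x) ^ 2 / 2 := by
      field_simp
    rw [gauss, he]
    field_simp
  have hs := intervalIntegral.mul_integral_comp_mul_left
    (f := fun x : ℝ => exp (-x ^ 2 / 2)) (a := d) (b := d + w) (c := σ⁻¹)
  simp only [V, hg, intervalIntegral.integral_const_mul]
  rw [hs, mul_comm σ⁻¹ d, mul_comm σ⁻¹ (d + w)]

/-- Rescaling both endpoints changes a Gaussian integral by a single integral over the scale. -/
lemma integral_exp_sub_integral_exp (a b s t : ℝ) :
    (∫ x in (a * t)..(b * t), exp (-x ^ 2 / 2)) - ∫ x in (a * s)..(b * s), exp (-x ^ 2 / 2) =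
      ∫ r in s..t, (b * exp (-(b * r) ^ 2 / 2) - a * exp (-(a * r) ^ 2 / 2)) := by
  have hi : ∀ u v : ℝ, IntervalIntegrable (fun x : ℝ => exp (-x ^ 2 / 2)) volume u v :=
    fun u v => Continuous.intervalIntegrable (by fun_prop) u v
  have hs (c : ℝ) := intervalIntegral.mul_integral_comp_mul_left
    (f := fun x : ℝ => exp (-x ^ 2 / 2)) (a := s) (b := t) (c := c)
  rw [intervalIntegral.integral_sub (Continuous.intervalIntegrable (by fun_prop) _ _)
      (Continuous.intervalIntegrable (by fun_prop) _ _),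
    intervalIntegral.integral_const_mul, intervalIntegral.integral_const_mul, hs, hs]
  have h₁ := intervalIntegral.integral_add_adjacent_intervals (hi (a * s) (a * t)) (hi _ (b * t))
  have h₂ := intervalIntegral.integral_add_adjacent_intervals (hi (a * s) (b * s)) (hi _ (b * t))
  linarith

/-- `sigmaStar d w` maximizes the value over all standard deviations. -/
lemma V_le_V_sigmaStar {d w σ : ℝ} (hd : 0 < d) (hw : 0 < w) (hσ : 0 < σ) :
    V σ d w ≤ V (sigmaStar d w) d w := by
  have hs := sigmaStar_pos hd hw
  have hkey := inv_sigmaStar_sq_mul hd hw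
  have hdw : 0 < d + w := by positivity
  have hp : 0 ≤ (d + w) ^ 2 - d ^ 2 := by nlinarith [mul_pos hd hw]
  rw [V_eq_integral_exp hσ, V_eq_integral_exp hs]
  refine mul_le_mul_of_nonneg_left ?_ (by positivity)
  rw [← sub_nonneg, integral_exp_sub_integral_exp]
  have ht := inv_pos.mpr hs
  have hu := inv_pos.mpr hσ
  rcases le_total σ⁻¹ (sigmaStar d w)⁻¹ with h | h
  · refine intervalIntegral.integral_nonneg h fun r hr => ?_
    rw [mul_exp_neg_sq_eq hdw, mul_exp_neg_sq_eq hd, sub_nonneg, exp_le_exp]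
    have hr2 : r ^ 2 ≤ (sigmaStar d w)⁻¹ ^ 2 := pow_le_pow_left₀ (hu.le.trans hr.1) hr.2 2
    linarith [mul_le_mul_of_nonneg_right hr2 hp]
  · rw [intervalIntegral.integral_symm, ← intervalIntegral.integral_neg]
    refine intervalIntegral.integral_nonneg h fun r hr => ?_
    rw [mul_exp_neg_sq_eq hdw, mul_exp_neg_sq_eq hd, neg_sub, sub_nonneg, exp_le_exp]
    have hr2 : (sigmaStar d w)⁻¹ ^ 2 ≤ r ^ 2 := pow_le_pow_left₀ ht.le hr.1 2
    linarith [mul_le_mul_of_nonneg_right hr2 hp]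

lemma gauss_lt_gauss {σ x y : ℝ} (hσ : 0 < σ) (hx : 0 ≤ x) (hxy : x < y) :
    gauss σ y < gauss σ x := by
  have := pow_lt_pow_left₀ hxy hx two_ne_zero
  unfold gauss
  gcongr

lemma V_lt_V_of_lt {σ w d₁ d₂ : ℝ} (hσ : 0 < σ) (hw : 0 < w) (hd₁ : 0 ≤ d₁) (h : d₁ < d₂) :
    V σ d₂ w < V σ d₁ w := by
  have hc : Continuous (gauss σ) := by
    unfold gauss
    fun_prop
  have hshift : V σ d₂ w = ∫ x in d₁..(d₁ + w), gauss σ (x + (d₂ - d₁)) := by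
    rw [V, intervalIntegral.integral_comp_add_right]
    congr 1 <;> ring
  rw [hshift, V]
  refine intervalIntegral.integral_lt_integral_of_continuousOn_of_le_of_exists_lt (by linarith)
    (by fun_prop) hc.continuousOn
    (fun x hx => (gauss_lt_gauss hσ (hd₁.trans hx.1.le) (by linarith)).le)
    ⟨d₁, ⟨le_rfl, by linarith⟩, gauss_lt_gauss hσ hd₁ (by linarith)⟩

theorem optimal_value_strictAnti_in_d (w : ℝ) (hw : 0 < w) :
    ∀ d₁ d₂ : ℝ, 0 < d₁ → d₁ < d₂ →
      V (sigmaStar d₂ w) d₂ w < V (sigmaStar d₁ w) d₁ w := by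
  intro d₁ d₂ hd₁ h
  have hσ := sigmaStar_pos (hd₁.trans h) hw
  exact (V_lt_V_of_lt hσ hw hd₁.le h).trans_le (V_le_V_sigmaStar hd₁ hw hσ)
end
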